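/- arXiv:1301.6875 — 2 statements merged into one kernel-verified Lean document; each statement's English description precedes it below -/
import Mathlib

section
/- Let O and O′ be maximal orders of B_p, and let D₁ = Nr(x), D₂ = Nr(y), D₃ = Nr(z) be the three successive minima of O^T. Suppose that D₁, D₂, Nr(x+y), Nr(x−y) and D₃ are all represented optimally by O′^T, that θ′_{O^T}(D₃) ≤ θ′_{O′^T}(D₃), and that D₁·D₂ < (16/3)·p, 15 ≤ D₁ and 286 < p. Then O and O′ are of the same type. -/
open scoped Quaternion

/-- The rational quaternion algebra with `i² = -p`, `j² = -q`. -/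
abbrev Bq (p q : ℕ) := ℍ[ℚ, -(p : ℚ), -(q : ℚ)]

namespace GrossPaper

variable {p q : ℕ}

/-- The (reduced) trace `Tr(x) = x + x̄` of a quaternion, as a rational number. -/
def Trq (x : Bq p q) : ℚ := 2 * x.re

/-- The (reduced) norm `Nr(x) = x·x̄` of a quaternion, as a rational number. -/
def Nrq (x : Bq p q) : ℚ := (x * star x).re

/-- The inverse of a nonzero quaternion: `c⁻¹ = star c / Nr c`. -/
noncomputable def qinv (c : Bq p q) : Bq p q := (Nrq c)⁻¹ • star c

/-- Conjugation of a set: `c S c⁻¹`. -/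
noncomputable def conjSet (c : Bq p q) (S : Set (Bq p q)) : Set (Bq p q) :=
  (fun s => c * s * qinv c) '' S

/-- An order of `B_p`: a subring (hence containing `ℤ`) which is a free `ℤ`-module of
rank 4 spanning `B_p` over `ℚ`. -/
def IsOrder (O : Subring (Bq p q)) : Prop :=
  Nonempty (Module.Basis (Fin 4) ℤ O) ∧ Submodule.span ℚ (O : Set (Bq p q)) = ⊤

/-- A maximal order: an order not properly contained in any other order. -/
def IsMaximalOrder (O : Subring (Bq p q)) : Prop :=
  IsOrder O ∧ ∀ O' : Subring (Bq p q), IsOrder O' → O ≤ O' → O' = O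

/-- Two orders are of the same type if they are conjugate. -/
noncomputable def SameType (O O' : Subring (Bq p q)) : Prop :=
  ∃ c : Bq p q, c ≠ 0 ∧ conjSet c (O : Set (Bq p q)) = (O' : Set (Bq p q))

/-- The Gross lattice `O^T = {2x - Tr(x) : x ∈ O}`. -/
def GrossLat (O : Subring (Bq p q)) : Set (Bq p q) :=
  {t | ∃ x ∈ O, t = 2 * x - algebraMap ℚ (Bq p q) (Trq x)}

/-- `SuccMin T i D` says `D` is the `i`-th successive minimum of `T`: the least real
number such that `T` contains `i` `ℚ`-linearly independent elements of norm at most `D`. -/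
def SuccMin (T : Set (Bq p q)) (i : ℕ) (D : ℝ) : Prop :=
  IsLeast {r : ℝ | ∃ v : Fin i → Bq p q, (∀ n, v n ∈ T) ∧ LinearIndependent ℚ v ∧
    ∀ n, ((Nrq (v n) : ℝ) ≤ r)} D

/-- A primitive element of the Gross lattice. -/
def Primitive (T : Set (Bq p q)) (t : Bq p q) : Prop :=
  t ∈ T ∧ t ≠ 0 ∧ ∀ (a : ℤ) (s : Bq p q), s ∈ T → t = a • s → a = 1 ∨ a = -1

/-- `k` is represented optimally by `T` : `Nr(t) = k` for some primitive `t ∈ T`. -/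
def OptRep (T : Set (Bq p q)) (k : ℝ) : Prop :=
  ∃ t : Bq p q, Primitive T t ∧ (Nrq t : ℝ) = k

/-- The multiplicity `θ_T(k)`: half the number of `t ∈ T` with `Nr t = k`. -/
noncomputable def theta (T : Set (Bq p q)) (k : ℝ) : ℚ :=
  ({t : Bq p q | t ∈ T ∧ (Nrq t : ℝ) = k}.ncard : ℚ) / 2

/-- The optimal multiplicity `θ'_T(k)`: half the number of primitive `t ∈ T` with `Nr t = k`. -/
noncomputable def thetaOpt (T : Set (Bq p q)) (k : ℝ) : ℚ :=
  ({t : Bq p q | Primitive T t ∧ (Nrq t : ℝ) = k}.ncard : ℚ) / 2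

end GrossPaper

open GrossPaper


namespace GrossPaper

lemma Nrq_eq {p q : ℕ} (t : Bq p q) :
    Nrq t = t.re ^ 2 + p * t.imI ^ 2 + q * t.imJ ^ 2 + p * q * t.imK ^ 2 := by
  simp [Nrq]; ring

lemma Nrq_mul {p q : ℕ} (s t : Bq p q) : Nrq (s * t) = Nrq s * Nrq t := by
  simp [Nrq_eq]; ring

lemma Nrq_one {p q : ℕ} : Nrq (1 : Bq p q) = 1 := by
  simp [Nrq_eq]

lemma Nrq_pow {p q : ℕ} (t : Bq p q) (n : ℕ) : Nrq (t ^ n) = Nrq t ^ n := by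
  induction n with
  | zero => simp [Nrq_one]
  | succ k ih => rw [pow_succ, pow_succ, Nrq_mul, ih]

lemma Nrq_pos {p q : ℕ} (hp : 0 < p) (hq : 0 < q) (t : Bq p q) (ht : t ≠ 0) : 0 < Nrq t := by
  have hp' : (0 : ℚ) < p := by exact_mod_cast hp
  have hq' : (0 : ℚ) < q := by exact_mod_cast hq
  rw [Nrq_eq]
  by_contra h
  apply ht
  have e1 : 0 ≤ t.re ^ 2 := by positivity
  have e2 : 0 ≤ p * t.imI ^ 2 := by positivity
  have e3 : 0 ≤ q * t.imJ ^ 2 := by positivity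
  have e4 : 0 ≤ p * q * t.imK ^ 2 := by positivity
  have f1 : t.re ^ 2 = 0 := by linarith
  have f2 : p * t.imI ^ 2 = 0 := by linarith
  have f3 : q * t.imJ ^ 2 = 0 := by linarith
  have f4 : p * q * t.imK ^ 2 = 0 := by linarith
  ext
  · simpa using f1
  · simpa [hp'.ne'] using f2
  · simpa [hq'.ne'] using f3
  · simpa [hp'.ne', hq'.ne'] using f4

lemma rat_den_one (r : ℚ) (N : ℤ) (hN : N ≠ 0) (h : ∀ n : ℕ, ∃ m : ℤ, (N : ℚ) * r ^ n = m) :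
    ∃ k : ℤ, r = k := by
  have hd : ∀ n : ℕ, r.den ^ n ≤ N.natAbs := by
    intro n
    obtain ⟨m, hm⟩ := h n
    have hN' : (N : ℚ) ≠ 0 := by exact_mod_cast hN
    have e : r ^ n = Rat.divInt m N := by
      rw [Rat.divInt_eq_div]; field_simp; linarith
    have := Rat.den_dvd m N
    rw [← e, Rat.den_pow] at this
    have h2 := Int.le_of_dvd (by positivity) (Int.dvd_natAbs.mpr this)
    exact_mod_cast h2
  have h1 : r.den = 1 := by
    by_contra hne
    have h2 : 1 < r.den := by have := r.den_pos; omega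
    have := hd N.natAbs
    have h3 := Nat.lt_pow_self h2 (n := N.natAbs)
    omega
  exact ⟨r.num, (Rat.den_eq_one_iff r).mp h1 |>.symm⟩

lemma exists_den {p q : ℕ} (O : Subring (Bq p q)) (hO : IsOrder O) :
    ∃ N : ℤ, N ≠ 0 ∧ ∀ t ∈ O, ∃ a b c d : ℤ, (N : ℚ) * t.re = a ∧ (N : ℚ) * t.imI = b ∧
      (N : ℚ) * t.imJ = c ∧ (N : ℚ) * t.imK = d := by
  obtain ⟨⟨e⟩, -⟩ := hO
  have key : ∀ f : Fin 4 → ℚ, ∃ N : ℤ, N ≠ 0 ∧ ∀ i, ∃ a : ℤ, (N : ℚ) * f i = a := by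
    intro f
    refine ⟨∏ i, ((f i).den : ℤ), Finset.prod_ne_zero_iff.mpr fun i _ => by
      exact_mod_cast (f i).den_nz, fun i => ?_⟩
    obtain ⟨c, hc⟩ := Finset.dvd_prod_of_mem (fun i => ((f i).den : ℤ)) (Finset.mem_univ i)
    refine ⟨c * (f i).num, ?_⟩
    rw [hc]
    push_cast
    have := Rat.den_mul_eq_num (f i)
    rw [mul_right_comm, this, mul_comm]
  obtain ⟨N1, h1, k1⟩ := key (fun i => (e i : Bq p q).re)
  obtain ⟨N2, h2, k2⟩ := key (fun i => (e i : Bq p q).imI)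
  obtain ⟨N3, h3, k3⟩ := key (fun i => (e i : Bq p q).imJ)
  obtain ⟨N4, h4, k4⟩ := key (fun i => (e i : Bq p q).imK)
  choose g1 k1 using k1
  choose g2 k2 using k2
  choose g3 k3 using k3
  choose g4 k4 using k4
  refine ⟨N1 * N2 * N3 * N4, by positivity, fun t ht => ?_⟩
  have hs := e.sum_repr ⟨t, ht⟩
  have hs' := congrArg (Subtype.val) hs
  simp only [Fin.sum_univ_four] at hs'
  push_cast at hs'
  set r := e.repr ⟨t, ht⟩
  rw [← hs']
  have mk1 := k1
  refine ⟨N2 * N3 * N4 * (r 0 * g1 0 + r 1 * g1 1 + r 2 * g1 2 + r 3 * g1 3),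
    N1 * N3 * N4 * (r 0 * g2 0 + r 1 * g2 1 + r 2 * g2 2 + r 3 * g2 3),
    N1 * N2 * N4 * (r 0 * g3 0 + r 1 * g3 1 + r 2 * g3 2 + r 3 * g3 3),
    N1 * N2 * N3 * (r 0 * g4 0 + r 1 * g4 1 + r 2 * g4 2 + r 3 * g4 3), ?_, ?_, ?_, ?_⟩
  · push_cast; rw [← k1, ← k1, ← k1, ← k1]; simp; ring
  · push_cast; rw [← k2, ← k2, ← k2, ← k2]; simp; ring
  · push_cast; rw [← k3, ← k3, ← k3, ← k3]; simp; ring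
  · push_cast; rw [← k4, ← k4, ← k4, ← k4]; simp; ring

lemma Nrq_int {p q : ℕ} (O : Subring (Bq p q)) (hO : IsOrder O) (t : Bq p q) (ht : t ∈ O) :
    ∃ k : ℤ, Nrq t = k := by
  obtain ⟨N, hN, h⟩ := exists_den O hO
  apply rat_den_one _ (N ^ 2) (by positivity)
  intro n
  obtain ⟨a, b, c, d, ha, hb, hc, hd⟩ := h _ (O.pow_mem ht n)
  refine ⟨a ^ 2 + p * b ^ 2 + q * c ^ 2 + p * q * d ^ 2, ?_⟩
  rw [← Nrq_pow, Nrq_eq]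
  push_cast
  rw [← ha, ← hb, ← hc, ← hd]; ring

lemma Trq_int {p q : ℕ} (O : Subring (Bq p q)) (hO : IsOrder O) (t : Bq p q) (ht : t ∈ O) :
    ∃ k : ℤ, Trq t = k := by
  obtain ⟨a, ha⟩ := Nrq_int O hO t ht
  obtain ⟨b, hb⟩ := Nrq_int O hO (1 + t) (O.add_mem O.one_mem ht)
  refine ⟨b - a - 1, ?_⟩
  push_cast
  rw [← ha, ← hb, Nrq_eq, Nrq_eq, Trq]; simp; ring

/-- p-integrality -/
def PInt (p : ℕ) (r : ℚ) : Prop := ∃ n : ℤ, ¬ (p : ℤ) ∣ n ∧ ∃ k : ℤ, (n : ℚ) * r = k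

lemma PInt.int (p : ℕ) (hp : p.Prime) (a : ℤ) : PInt p (a : ℚ) :=
  ⟨1, by intro h; have := Int.eq_one_of_dvd_one (by positivity) h; have := hp.one_lt; omega,
    a, by simp⟩

lemma PInt.mul {p : ℕ} (hp : p.Prime) {r s : ℚ} (hr : PInt p r) (hs : PInt p s) :
    PInt p (r * s) := by
  obtain ⟨n, hn, a, ha⟩ := hr
  obtain ⟨m, hm, b, hb⟩ := hs
  refine ⟨n * m, ?_, a * b, ?_⟩
  · rw [(Nat.prime_iff_prime_int.mp hp).dvd_mul]; tauto
  · push_cast; rw [← ha, ← hb]; ring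

lemma PInt.add {p : ℕ} (hp : p.Prime) {r s : ℚ} (hr : PInt p r) (hs : PInt p s) :
    PInt p (r + s) := by
  obtain ⟨n, hn, a, ha⟩ := hr
  obtain ⟨m, hm, b, hb⟩ := hs
  refine ⟨n * m, ?_, a * m + b * n, ?_⟩
  · rw [(Nat.prime_iff_prime_int.mp hp).dvd_mul]; tauto
  · push_cast; rw [← ha, ← hb]; ring

lemma PInt.sub {p : ℕ} (hp : p.Prime) {r s : ℚ} (hr : PInt p r) (hs : PInt p s) :
    PInt p (r - s) := by
  have := hr.add hp ((PInt.int p hp (-1)).mul hp hs)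
  convert this using 1
  push_cast; ring

lemma PInt.dvd {p : ℕ} (hp : p.Prime) {r : ℚ} (hr : PInt p r) (K : ℤ) (h : (K : ℚ) = p * r) :
    (p : ℤ) ∣ K := by
  obtain ⟨n, hn, a, ha⟩ := hr
  have : n * K = p * a := by
    have : (n : ℚ) * K = p * a := by rw [h, ← ha]; ring
    exact_mod_cast this
  have h2 : (p : ℤ) ∣ n * K := ⟨a, this⟩
  exact ((Nat.prime_iff_prime_int.mp hp).dvd_or_dvd h2).resolve_left hn

lemma form_descent {p : ℕ} (hp : p.Prime) (m : ℤ)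
    (hm : ∀ X Y : ℤ, (p : ℤ) ∣ X ^ 2 + m * Y ^ 2 → (p : ℤ) ∣ X ∧ (p : ℤ) ∣ Y)
    (X Y Z W : ℤ) (h : (p : ℤ) ^ 2 ∣ X ^ 2 + m * Y ^ 2 + p * (Z ^ 2 + m * W ^ 2)) :
    (p : ℤ) ∣ X ∧ (p : ℤ) ∣ Y ∧ (p : ℤ) ∣ Z ∧ (p : ℤ) ∣ W := by
  have hp0 : (p : ℤ) ≠ 0 := by exact_mod_cast hp.ne_zero
  obtain ⟨c, hc⟩ := h
  have h1 : (p : ℤ) ∣ X ^ 2 + m * Y ^ 2 := ⟨p * c - (Z ^ 2 + m * W ^ 2), by linarith⟩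
  obtain ⟨⟨x, rfl⟩, ⟨y, rfl⟩⟩ := hm X Y h1
  refine ⟨⟨x, rfl⟩, ⟨y, rfl⟩, ?_⟩
  apply hm
  refine ⟨c - (x ^ 2 + m * y ^ 2), ?_⟩
  apply mul_left_cancel₀ hp0
  linarith

lemma form_pint {p : ℕ} (hp : p.Prime) (m : ℤ)
    (hm : ∀ X Y : ℤ, (p : ℤ) ∣ X ^ 2 + m * Y ^ 2 → (p : ℤ) ∣ X ∧ (p : ℤ) ∣ Y)
    (X Y Z W : ℚ) (K : ℤ) (h : X ^ 2 + m * Y ^ 2 + p * (Z ^ 2 + m * W ^ 2) = K) :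
    ∃ n : ℤ, ¬ (p : ℤ) ∣ n ∧ ∃ a b c d : ℤ, n * X = a ∧ n * Y = b ∧ n * Z = c ∧ n * W = d := by
  have hp0 : (p : ℚ) ≠ 0 := by exact_mod_cast hp.ne_zero
  have main : ∀ N : ℕ, N ≠ 0 → (∃ a b c d : ℤ, N * X = a ∧ N * Y = b ∧ N * Z = c ∧ N * W = d) →
      ∃ n : ℤ, ¬ (p : ℤ) ∣ n ∧ ∃ a b c d : ℤ, n * X = a ∧ n * Y = b ∧ n * Z = c ∧ n * W = d := by
    intro N
    induction N using Nat.strong_induction_on with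
    | _ N ih =>
      intro hN ⟨a, b, c, d, ha, hb, hc, hd⟩
      by_cases hd' : p ∣ N
      · obtain ⟨M, rfl⟩ := hd'
        have hM : M ≠ 0 := by rintro rfl; simp at hN
        have : a ^ 2 + m * b ^ 2 + p * (c ^ 2 + m * d ^ 2) = (p : ℤ) ^ 2 * (M ^ 2 * K) := by
          have : (a : ℚ) ^ 2 + m * b ^ 2 + p * (c ^ 2 + m * d ^ 2) = p ^ 2 * (M ^ 2 * K) := by
            rw [← ha, ← hb, ← hc, ← hd, ← h]; push_cast; ring
          exact_mod_cast this
        obtain ⟨⟨a', rfl⟩, ⟨b', rfl⟩, ⟨c', rfl⟩, ⟨d', rfl⟩⟩ :=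
          form_descent hp m hm a b c d ⟨_, this⟩
        push_cast at ha hb hc hd
        refine ih M ?_ hM ⟨a', b', c', d', ?_, ?_, ?_, ?_⟩
        · have := hp.one_lt
          have : 0 < M := Nat.pos_of_ne_zero hM
          nlinarith
        all_goals
          apply mul_left_cancel₀ hp0
          linarith
      · exact ⟨N, by exact_mod_cast hd', a, b, c, d, by exact_mod_cast ha, by exact_mod_cast hb,
          by exact_mod_cast hc, by exact_mod_cast hd⟩
  apply main (X.den * Y.den * Z.den * W.den)
  · simp
  · refine ⟨X.num * Y.den * Z.den * W.den, X.den * Y.num * Z.den * W.den,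
      X.den * Y.den * Z.num * W.den, X.den * Y.den * Z.den * W.num, ?_, ?_, ?_, ?_⟩ <;> push_cast
    · rw [← Rat.den_mul_eq_num X]; ring
    · rw [← Rat.den_mul_eq_num Y]; ring
    · rw [← Rat.den_mul_eq_num Z]; ring
    · rw [← Rat.den_mul_eq_num W]; ring

lemma form_dvd {p : ℕ} (hp : p.Prime) (m : ℤ)
    (hm : ∀ X Y : ℤ, (p : ℤ) ∣ X ^ 2 + m * Y ^ 2 → (p : ℤ) ∣ X ∧ (p : ℤ) ∣ Y)
    (X Y Z W : ℚ) (K : ℤ) (h : X ^ 2 + m * Y ^ 2 + p * (Z ^ 2 + m * W ^ 2) = K)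
    (hK : (p : ℤ) ∣ K) (l : ℤ) (hl : 2 * X = l) : (p : ℤ) ∣ l := by
  obtain ⟨n, hn, a, b, c, d, ha, hb, hc, hd⟩ := form_pint hp m hm X Y Z W K h
  obtain ⟨k, rfl⟩ := hK
  have : (p : ℤ) ∣ a ^ 2 + m * b ^ 2 := by
    refine ⟨n ^ 2 * k - (c ^ 2 + m * d ^ 2), ?_⟩
    have : (a : ℚ) ^ 2 + m * b ^ 2 = p * (n ^ 2 * k - (c ^ 2 + m * d ^ 2)) := by
      rw [← ha, ← hb, ← hc, ← hd]
      push_cast at h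
      linear_combination (n : ℚ) ^ 2 * h
    exact_mod_cast this
  have h2 := (hm a b this).1
  have h3 : n * l = 2 * a := by
    have : (n : ℚ) * l = 2 * a := by rw [← hl, ← ha]; ring
    exact_mod_cast this
  have h4 : (p : ℤ) ∣ n * l := h3 ▸ Dvd.dvd.mul_left h2 2
  exact ((Nat.prime_iff_prime_int.mp hp).dvd_or_dvd h4).resolve_left hn

lemma aniso_of_nonsq {p : ℕ} (hp : p.Prime) (m : ℤ) (hm : ¬ IsSquare (-(m : ZMod p)))
    (X Y : ℤ) (h : (p : ℤ) ∣ X ^ 2 + m * Y ^ 2) : (p : ℤ) ∣ X ∧ (p : ℤ) ∣ Y := by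
  have := Fact.mk hp
  rw [← ZMod.intCast_zmod_eq_zero_iff_dvd, ← ZMod.intCast_zmod_eq_zero_iff_dvd]
  rw [← ZMod.intCast_zmod_eq_zero_iff_dvd] at h
  push_cast at h
  by_cases hY : (Y : ZMod p) = 0
  · rw [hY] at h
    simp at h
    exact ⟨h, hY⟩
  · exfalso
    apply hm
    refine ⟨X / Y, ?_⟩
    field_simp
    linear_combination -h

lemma nonsq_q {p q : ℕ} (hp : p.Prime) (hodd : Odd p) (hq : q.Prime) (hq8 : q % 8 = 3)
    (hqr : ∃ r : ℤ, (q : ℤ) ∣ r ^ 2 + p) (hne : p ≠ q) : ¬ IsSquare (-((q : ℤ) : ZMod p)) := by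
  have := Fact.mk hp
  have := Fact.mk hq
  have hp2 : p ≠ 2 := by rintro rfl; revert hodd; decide
  have hq2 : q ≠ 2 := by omega
  have hqp : (p : ZMod q) ≠ 0 := by
    rw [Ne, ZMod.natCast_eq_zero_iff]
    intro h; exact hne ((Nat.prime_dvd_prime_iff_eq hq hp).mp h).symm
  have hpq : (q : ZMod p) ≠ 0 := by
    rw [Ne, ZMod.natCast_eq_zero_iff]
    intro h; exact hne ((Nat.prime_dvd_prime_iff_eq hp hq).mp h)
  have h1 : legendreSym q (-p : ℤ) = 1 := by
    rw [legendreSym.eq_one_iff q (by push_cast; simpa using hqp)]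
    obtain ⟨r, hr⟩ := hqr
    rw [← ZMod.intCast_zmod_eq_zero_iff_dvd] at hr
    push_cast at hr ⊢
    exact ⟨r, by linear_combination -hr⟩
  have h2 : legendreSym q (-1) = -1 := by
    rw [legendreSym.at_neg_one hq2, ZMod.χ₄_nat_three_mod_four (by omega)]
  have h3 : legendreSym q p = -1 := by
    have : legendreSym q (-p : ℤ) = legendreSym q (-1) * legendreSym q p := by
      rw [← legendreSym.mul]; simp
    rw [h1, h2] at this; linarith
  have h4 : legendreSym p (-q : ℤ) = -1 := by
    have : legendreSym p (-q : ℤ) = legendreSym p (-1) * legendreSym p q := by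
      rw [← legendreSym.mul]; simp
    rw [this, legendreSym.at_neg_one hp2]
    rcases (by have := hodd; rw [Nat.odd_iff] at this; omega : p % 4 = 1 ∨ p % 4 = 3) with h | h
    · rw [ZMod.χ₄_nat_one_mod_four h]
      have := legendreSym.quadratic_reciprocity_one_mod_four h hq2
      rw [← this, h3]; rfl
    · rw [ZMod.χ₄_nat_three_mod_four h]
      have := legendreSym.quadratic_reciprocity_three_mod_four h (by omega : q % 4 = 3)
      rw [h3] at this
      linarith
  rw [legendreSym.eq_neg_one_iff] at h4
  push_cast at h4 ⊢
  exact h4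

lemma local_facts {p q : ℕ} (hp : p.Prime) (hodd : Odd p) (hq : q.Prime) (hq8 : q % 8 = 3)
    (hqr : ∃ r : ℤ, (q : ℤ) ∣ r ^ 2 + p) (O : Subring (Bq p q)) (hO : IsOrder O) :
    (∀ s ∈ O, ∀ t ∈ O, ∃ k : ℤ, Nrq (s * t - t * s) = p * k) ∧
    (∀ s ∈ O, ∀ k : ℤ, Nrq s = p * k → ∃ l : ℤ, Trq s = p * l) := by
  by_cases hne : p = q
  · subst hne
    have hm : ∀ X Y : ℤ, (p : ℤ) ∣ X ^ 2 + 1 * Y ^ 2 → (p : ℤ) ∣ X ∧ (p : ℤ) ∣ Y := by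
      apply aniso_of_nonsq hp
      have := Fact.mk hp
      push_cast
      rw [ZMod.exists_sq_eq_neg_one_iff]; omega
    constructor
    · intro s hs t ht
      obtain ⟨K, hK⟩ := Nrq_int O hO _ hs
      obtain ⟨L, hL⟩ := Nrq_int O hO _ ht
      obtain ⟨M, hM⟩ := Nrq_int O hO _ (O.sub_mem (O.mul_mem hs ht) (O.mul_mem ht hs))
      obtain ⟨n, hn, a, b, c, d, ha, hb, hc, hd⟩ := form_pint hp 1 hm s.re (p * s.imK) s.imI s.imJ K
        (by rw [← hK, Nrq_eq]; push_cast; ring)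
      obtain ⟨n', hn', a', b', c', d', ha', hb', hc', hd'⟩ := form_pint hp 1 hm t.re (p * t.imK)
        t.imI t.imJ L (by rw [← hL, Nrq_eq]; push_cast; ring)
      have s1 : PInt p (p * s.imK) := ⟨n, hn, b, hb⟩
      have s2 : PInt p s.imI := ⟨n, hn, c, hc⟩
      have s3 : PInt p s.imJ := ⟨n, hn, d, hd⟩
      have t1 : PInt p (p * t.imK) := ⟨n', hn', b', hb'⟩
      have t2 : PInt p t.imI := ⟨n', hn', c', hc'⟩
      have t3 : PInt p t.imJ := ⟨n', hn', d', hd'⟩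
      have u1 := (s3.mul hp t1).sub hp (t3.mul hp s1)
      have u2 := (s2.mul hp t1).sub hp (t2.mul hp s1)
      have u3 := (s2.mul hp t3).sub hp (t2.mul hp s3)
      have v := (((PInt.int p hp 4).mul hp (u1.mul hp u1)).add hp
        ((PInt.int p hp 4).mul hp (u2.mul hp u2))).add hp
        ((PInt.int p hp (4 * p)).mul hp (u3.mul hp u3))
      obtain ⟨k, hk⟩ := v.dvd hp M (by rw [← hM, Nrq_eq]; simp; ring)
      exact ⟨k, by rw [hM, hk]; push_cast; ring⟩
    · intro s hs k hk
      obtain ⟨l, hl⟩ := Trq_int O hO s hs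
      obtain ⟨l', hl'⟩ := form_dvd hp 1 hm s.re (p * s.imK) s.imI s.imJ (p * k)
        (by push_cast; rw [← hk, Nrq_eq]; ring) ⟨k, rfl⟩ l (by rw [← hl, Trq])
      exact ⟨l', by rw [hl, hl']; push_cast; ring⟩
  · have hm : ∀ X Y : ℤ, (p : ℤ) ∣ X ^ 2 + q * Y ^ 2 → (p : ℤ) ∣ X ∧ (p : ℤ) ∣ Y :=
      aniso_of_nonsq hp _ (nonsq_q hp hodd hq hq8 hqr hne)
    constructor
    · intro s hs t ht
      obtain ⟨K, hK⟩ := Nrq_int O hO _ hs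
      obtain ⟨L, hL⟩ := Nrq_int O hO _ ht
      obtain ⟨M, hM⟩ := Nrq_int O hO _ (O.sub_mem (O.mul_mem hs ht) (O.mul_mem ht hs))
      obtain ⟨n, hn, a, b, c, d, ha, hb, hc, hd⟩ := form_pint hp q hm s.re s.imJ s.imI s.imK K
        (by rw [← hK, Nrq_eq]; push_cast; ring)
      obtain ⟨n', hn', a', b', c', d', ha', hb', hc', hd'⟩ := form_pint hp q hm t.re t.imJ
        t.imI t.imK L (by rw [← hL, Nrq_eq]; push_cast; ring)
      have s1 : PInt p (s.imK) := ⟨n, hn, d, hd⟩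
      have s2 : PInt p s.imI := ⟨n, hn, c, hc⟩
      have s3 : PInt p s.imJ := ⟨n, hn, b, hb⟩
      have t1 : PInt p (t.imK) := ⟨n', hn', d', hd'⟩
      have t2 : PInt p t.imI := ⟨n', hn', c', hc'⟩
      have t3 : PInt p t.imJ := ⟨n', hn', b', hb'⟩
      have u1 := (s3.mul hp t1).sub hp (t3.mul hp s1)
      have u2 := (s2.mul hp t1).sub hp (t2.mul hp s1)
      have u3 := (s2.mul hp t3).sub hp (t2.mul hp s3)
      have v := (((PInt.int p hp (4 * q ^ 2)).mul hp (u1.mul hp u1)).add hp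
        ((PInt.int p hp (4 * p * q)).mul hp (u2.mul hp u2))).add hp
        ((PInt.int p hp (4 * q)).mul hp (u3.mul hp u3))
      obtain ⟨k, hk⟩ := v.dvd hp M (by rw [← hM, Nrq_eq]; simp; ring)
      exact ⟨k, by rw [hM, hk]; push_cast; ring⟩
    · intro s hs k hk
      obtain ⟨l, hl⟩ := Trq_int O hO s hs
      obtain ⟨l', hl'⟩ := form_dvd hp q hm s.re s.imJ s.imI s.imK (p * k)
        (by push_cast; rw [← hk, Nrq_eq]; ring) ⟨k, rfl⟩ l (by rw [← hl, Trq])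
      exact ⟨l', by rw [hl, hl']; push_cast; ring⟩

end GrossPaper
namespace GrossPaper

set_option linter.unusedSimpArgs false

/-- bilinear form -/
def Bl {p q : ℕ} (x y : Bq p q) : ℚ := (x * star y).re

lemma rat_sq_int (r : ℚ) (k : ℤ) (h : r ^ 2 = k) : ∃ n : ℤ, r = n := by
  have h1 : (r ^ 2).den = 1 := by rw [h]; simp
  rw [Rat.den_pow] at h1
  have h2 : r.den = 1 := by
    simpa using h1
  exact ⟨r.num, (Rat.den_eq_one_iff r).mp h2 |>.symm⟩

lemma expand {p q : ℕ} (a b t : Bq p q) :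
    ∃ c : ℚ, (Nrq (a * b - b * a)) • t = algebraMap ℚ (Bq p q) c
      + ((t * b - b * t) * star (a * b - b * a)).re • a
      + ((a * t - t * a) * star (a * b - b * a)).re • b
      + (t * star (a * b - b * a)).re • (a * b - b * a) := by
  have com : ∀ s t : Bq p q, s * t - t * s = ⟨0, 2 * q * (t.imJ * s.imK - t.imK * s.imJ) * (-1),
      2 * p * (t.imI * s.imK - t.imK * s.imI), 2 * (s.imI * t.imJ - t.imI * s.imJ)⟩ := by
    intro s t
    ext <;> simp <;> ring
  obtain ⟨c, hc⟩ : ∃ c : ℚ, c = Nrq (a * b - b * a) * t.re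
    - ((t * b - b * t) * star (a * b - b * a)).re * a.re
    - ((a * t - t * a) * star (a * b - b * a)).re * b.re := ⟨_, rfl⟩
  refine ⟨c, ?_⟩
  rw [Nrq_eq, com a b, com t b, com a t] at hc ⊢
  ext
  · rw [QuaternionAlgebra.re_add, QuaternionAlgebra.re_add, QuaternionAlgebra.re_add,
      QuaternionAlgebra.algebraMap_eq, hc]
    simp
    ring
  all_goals
    simp
    ring

lemma span_eq {p q : ℕ} (hp : p.Prime) (O : Subring (Bq p q)) (hO : IsOrder O)
    (hl1 : ∀ s ∈ O, ∀ t ∈ O, ∃ k : ℤ, Nrq (s * t - t * s) = p * k)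
    (hl2 : ∀ s ∈ O, ∀ k : ℤ, Nrq s = p * k → ∃ l : ℤ, Trq s = p * l)
    (a b : Bq p q) (ha : a ∈ O) (hb : b ∈ O) (hab : Nrq (a * b - b * a) = p)
    (t : Bq p q) (ht : t ∈ O) :
    ∃ n0 n1 n2 n3 : ℤ, t = (n0 : Bq p q) + n1 • a + n2 • b + n3 • (a * b) := by
  have hp0 : (p : ℚ) ≠ 0 := by exact_mod_cast hp.ne_zero
  set w := a * b - b * a with hw
  have hwO : w ∈ O := O.sub_mem (O.mul_mem ha hb) (O.mul_mem hb ha)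
  have hsw : star w = -w := by
    rw [hw]; ext <;> simp <;> ring
  obtain ⟨k, hk⟩ := Nrq_int O hO t ht
  obtain ⟨l, hl⟩ := hl2 (t * star w) (O.mul_mem ht (hsw ▸ O.neg_mem hwO)) k (by
    have h0 : Nrq (star w) = Nrq w := by rw [Nrq_eq, Nrq_eq]; simp
    rw [Nrq_mul, hk, h0, hab]; ring)
  have hγab : 2 * ((a * b) * star w).re = p := by
    refine Eq.trans ?_ hab
    rw [hw, Nrq_eq]; simp; ring
  set u := t - l • (a * b) with hu
  have huO : u ∈ O := O.sub_mem ht (O.zsmul_mem (O.mul_mem ha hb) l)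
  have hγ : (u * star w).re = 0 := by
    have h1 : (u * star w).re = (t * star w).re - l * ((a * b) * star w).re := by
      rw [hu, sub_mul, zsmul_eq_mul, mul_assoc, ← zsmul_eq_mul]
      simp
    rw [Trq] at hl
    rw [h1]
    linear_combination (1/2 : ℚ) * hl - (l : ℚ) / 2 * hγab
  obtain ⟨c, hc⟩ := expand a b u
  rw [← hw, hγ, hab, zero_smul, add_zero] at hc
  set α := ((u * b - b * u) * star w).re with hα
  set β := ((a * u - u * a) * star w).re with hβ
  have e1 : (p : ℚ) • (u * b - b * u) = α • w := by
    have : (p : ℚ) • (u * b - b * u) = ((p : ℚ) • u) * b - b * ((p : ℚ) • u) := by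
      rw [smul_sub, smul_mul_assoc, mul_smul_comm]
    rw [this, hc, hw]
    simp only [add_mul, mul_add, smul_mul_assoc, mul_smul_comm, ← Algebra.commutes c b, smul_sub]
    abel
  have e2 : (p : ℚ) • (a * u - u * a) = β • w := by
    have : (p : ℚ) • (a * u - u * a) = a * ((p : ℚ) • u) - ((p : ℚ) • u) * a := by
      rw [smul_sub, smul_mul_assoc, mul_smul_comm]
    rw [this, hc, hw]
    simp only [add_mul, mul_add, smul_mul_assoc, mul_smul_comm, ← Algebra.commutes c a, smul_sub]
    abel
  have hsm : ∀ (r : ℚ) (s : Bq p q), Nrq (r • s) = r ^ 2 * Nrq s := by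
    intro r s; rw [Nrq_eq, Nrq_eq]; simp; ring
  have gen : ∀ (r : ℚ) (s : Bq p q) (k : ℤ), Nrq s = p * k → (p : ℚ) • s = r • w →
      ∃ n : ℤ, r = p * n := by
    intro r s k hs he
    have h1 := congrArg Nrq he
    rw [hsm, hsm, hs, hab] at h1
    obtain ⟨n, hn⟩ := rat_sq_int (r / p) k (by field_simp; field_simp at h1; linarith)
    exact ⟨n, by rw [← hn]; field_simp⟩
  obtain ⟨k1, hk1⟩ := hl1 u huO b hb
  obtain ⟨k2, hk2⟩ := hl1 a ha u huO
  obtain ⟨n1, hn1⟩ := gen _ _ k1 hk1 e1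
  obtain ⟨n2, hn2⟩ := gen _ _ k2 hk2 e2
  have hu2 : u - n1 • a - n2 • b = algebraMap ℚ (Bq p q) (c / p) := by
    have h1 : (p : ℚ) • (u - n1 • a - n2 • b) = (p : ℚ) • algebraMap ℚ (Bq p q) (c / p) := by
      rw [smul_sub, smul_sub, hc, hn1, hn2]
      · rw [← Int.cast_smul_eq_zsmul ℚ n1 a, ← Int.cast_smul_eq_zsmul ℚ n2 b, smul_smul, smul_smul,
          Algebra.algebraMap_eq_smul_one, Algebra.algebraMap_eq_smul_one, smul_smul,
          mul_div_cancel₀ _ hp0]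
        abel
    exact smul_right_injective _ hp0 h1
  have hmem : u - n1 • a - n2 • b ∈ O :=
    O.sub_mem (O.sub_mem huO (O.zsmul_mem ha _)) (O.zsmul_mem hb _)
  rw [hu2] at hmem
  obtain ⟨k3, hk3⟩ := Nrq_int O hO _ hmem
  obtain ⟨n0, hn0⟩ := rat_sq_int (c / p) k3 (by rw [← hk3, Nrq_eq]; simp)
  refine ⟨n0, n1, n2, l, ?_⟩
  rw [hn0] at hu2
  have : (algebraMap ℚ (Bq p q)) (n0 : ℚ) = (n0 : Bq p q) := by simp
  rw [this] at hu2
  rw [← hu2, hu]; abel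

lemma intertwine {p q : ℕ} (x v x' v' e : Bq p q) (D N : ℚ)
    (hx : x * x = -(D • 1)) (hx' : x' * x' = -(D • 1))
    (hv : v * v = -(N • 1)) (hv' : v' * v' = -(N • 1))
    (ha : v * x = -(x * v)) (ha' : v' * x' = -(x' * v'))
    (c : Bq p q) (hc : c = (D * N) • e - N • (x' * e * x) - D • (v' * e * v)
      + (x' * v') * e * (v * x)) :
    c * x = x' * c ∧ c * v = v' * c := by
  have hx2 : ∀ t, x * (x * t) = -(D • t) := fun t => by rw [← mul_assoc, hx]; simp
  have hx2' : ∀ t, x' * (x' * t) = -(D • t) := fun t => by rw [← mul_assoc, hx']; simp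
  have hv2 : ∀ t, v * (v * t) = -(N • t) := fun t => by rw [← mul_assoc, hv]; simp
  have hv2' : ∀ t, v' * (v' * t) = -(N • t) := fun t => by rw [← mul_assoc, hv']; simp
  have ha2 : ∀ t, v * (x * t) = -(x * (v * t)) := fun t => by rw [← mul_assoc, ha]; simp [mul_assoc]
  have ha2' : ∀ t, v' * (x' * t) = -(x' * (v' * t)) :=
    fun t => by rw [← mul_assoc, ha']; simp [mul_assoc]
  subst hc
  constructor
  · simp only [add_mul, sub_mul, mul_add, mul_sub, mul_assoc, smul_mul_assoc, mul_smul_comm,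
      hx, hx', hv, hv', ha, ha', hx2, hx2', hv2, hv2', ha2, ha2', mul_neg, neg_mul, smul_neg,
      neg_neg, mul_one, smul_smul]
    module
  · simp only [add_mul, sub_mul, mul_add, mul_sub, mul_assoc, smul_mul_assoc, mul_smul_comm,
      hx, hx', hv, hv', ha, ha', hx2, hx2', hv2, hv2', ha2, ha2', mul_neg, neg_mul, smul_neg,
      neg_neg, mul_one, smul_smul]
    module

lemma trace_lem {p q : ℕ} (g h : Bq p q) :
    (g * 1 * h).re + (g * ⟨0, 1, 0, 0⟩ * h).imI + (g * ⟨0, 0, 1, 0⟩ * h).imJ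
      + (g * ⟨0, 0, 0, 1⟩ * h).imK = 4 * g.re * h.re := by
  simp; ring

lemma exists_intertwiner {p q : ℕ} (x v x' v' : Bq p q) (D N : ℚ) (hD : D ≠ 0) (hN : N ≠ 0)
    (hx : x * x = -(D • 1)) (hx' : x' * x' = -(D • 1))
    (hv : v * v = -(N • 1)) (hv' : v' * v' = -(N • 1))
    (ha : v * x = -(x * v)) (ha' : v' * x' = -(x' * v'))
    (rx : x.re = 0) (rv : v.re = 0) (rvx : (v * x).re = 0) :
    ∃ c : Bq p q, c ≠ 0 ∧ c * x = x' * c ∧ c * v = v' * c := by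
  let C : Bq p q → Bq p q := fun e => (D * N) • e - N • (x' * e * x) - D • (v' * e * v)
      + (x' * v') * e * (v * x)
  have hC : ∀ e, C e * x = x' * C e ∧ C e * v = v' * C e := fun e =>
    intertwine x v x' v' e D N hx hx' hv hv' ha ha' _ rfl
  by_contra hcon
  push Not at hcon
  have hz : ∀ e, C e = 0 := by
    intro e
    by_contra h
    exact hcon _ h (hC e).1 (hC e).2
  have z1 := congrArg QuaternionAlgebra.re (hz 1)
  have z2 := congrArg QuaternionAlgebra.imI (hz ⟨0, 1, 0, 0⟩)
  have z3 := congrArg QuaternionAlgebra.imJ (hz ⟨0, 0, 1, 0⟩)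
  have z4 := congrArg QuaternionAlgebra.imK (hz ⟨0, 0, 0, 1⟩)
  have t1 := trace_lem x' x
  have t2 := trace_lem v' v
  have t3 := trace_lem (x' * v') (v * x)
  rw [rx] at t1
  rw [rv] at t2
  rw [rvx] at t3
  simp only [C, QuaternionAlgebra.re_add, QuaternionAlgebra.re_sub, QuaternionAlgebra.re_smul,
    QuaternionAlgebra.imI_add, QuaternionAlgebra.imI_sub, QuaternionAlgebra.imI_smul,
    QuaternionAlgebra.imJ_add, QuaternionAlgebra.imJ_sub, QuaternionAlgebra.imJ_smul,
    QuaternionAlgebra.imK_add, QuaternionAlgebra.imK_sub, QuaternionAlgebra.imK_smul,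
    QuaternionAlgebra.re_zero, QuaternionAlgebra.imI_zero, QuaternionAlgebra.imJ_zero,
    QuaternionAlgebra.imK_zero, QuaternionAlgebra.re_one, smul_eq_mul] at z1 z2 z3 z4
  have : 4 * (D * N) = 0 := by
    linear_combination z1 + z2 + z3 + z4 + N * t1 + D * t2 - t3
  have h4 : D * N ≠ 0 := mul_ne_zero hD hN
  apply h4; linarith

lemma exists_conj {p q : ℕ} (x y x' y' : Bq p q) 
    (rx : x.re = 0) (ry : y.re = 0) (rx' : x'.re = 0) (ry' : y'.re = 0)
    (h1 : Nrq x = Nrq x') (h2 : Nrq y = Nrq y') (h3 : Bl x y = Bl x' y')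
    (hD : Nrq x ≠ 0) (hN : Nrq x * Nrq y - Bl x y ^ 2 ≠ 0) :
    ∃ c : Bq p q, c ≠ 0 ∧ c * x = x' * c ∧ c * y = y' * c := by
  have sq : ∀ t : Bq p q, t.re = 0 → t * t = -(Nrq t • 1) := by
    intro t ht
    rw [Nrq_eq]; ext <;> simp [ht] <;> ring
  have anti : ∀ s t : Bq p q, s.re = 0 → t.re = 0 →
      (Nrq s • t - Bl s t • s) * s = -(s * (Nrq s • t - Bl s t • s)) := by
    intro s t hs ht
    rw [Nrq_eq, Bl]; ext <;> simp [hs, ht] <;> ring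
  have nrm : ∀ s t : Bq p q, s.re = 0 → t.re = 0 →
      Nrq (Nrq s • t - Bl s t • s) = Nrq s * (Nrq s * Nrq t - Bl s t ^ 2) := by
    intro s t hs ht
    rw [Nrq_eq (_ - _), Bl, Nrq_eq s, Nrq_eq t]; simp [hs, ht]; ring
  have rv : ∀ (s t : Bq p q) (m n : ℚ), s.re = 0 → t.re = 0 → (m • t - n • s).re = 0 := by
    intro s t m n hs ht; simp [hs, ht]
  have hv := sq _ (rv x y (Nrq x) (Bl x y) rx ry)
  have hv' := sq _ (rv x' y' (Nrq x') (Bl x' y') rx' ry')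
  rw [nrm x y rx ry] at hv
  rw [nrm x' y' rx' ry', ← h1, ← h2, ← h3] at hv'
  have ha' := anti x' y' rx' ry'
  rw [← h1, ← h3] at ha'
  obtain ⟨c, hc0, hcx, hcv⟩ := exists_intertwiner x (Nrq x • y - Bl x y • x) x'
    (Nrq x • y' - Bl x y • x') (Nrq x) (Nrq x * (Nrq x * Nrq y - Bl x y ^ 2)) hD
    (mul_ne_zero hD hN) (sq x rx) (h1 ▸ sq x' rx') hv hv' (anti x y rx ry) ha' rx
    (rv _ _ _ _ rx ry) (by rw [Nrq_eq, Bl]; simp [rx, ry]; ring)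
  refine ⟨c, hc0, hcx, ?_⟩
  have : Nrq x • (c * y) = Nrq x • (y' * c) := by
    simp only [mul_sub, sub_mul, mul_smul_comm, smul_mul_assoc, hcx] at hcv
    exact sub_left_injective hcv
  exact smul_right_injective _ hD this

end GrossPaper
namespace GrossPaper

lemma gross_eq {p q : ℕ} (a : Bq p q) : 2 * a - algebraMap ℚ (Bq p q) (Trq a)
    = ⟨0, 2 * a.imI, 2 * a.imJ, 2 * a.imK⟩ := by
  rw [QuaternionAlgebra.algebraMap_eq, two_mul, Trq]
  ext <;> simp <;> ring

lemma gross_re {p q : ℕ} {O : Subring (Bq p q)} {x : Bq p q} (hx : x ∈ GrossLat O) :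
    x.re = 0 := by
  obtain ⟨a, -, rfl⟩ := hx
  rw [gross_eq]

lemma gross_add {p q : ℕ} {O : Subring (Bq p q)} {x y : Bq p q} (hx : x ∈ GrossLat O)
    (hy : y ∈ GrossLat O) : x + y ∈ GrossLat O := by
  obtain ⟨a, ha, rfl⟩ := hx
  obtain ⟨b, hb, rfl⟩ := hy
  refine ⟨a + b, O.add_mem ha hb, ?_⟩
  rw [gross_eq, gross_eq, gross_eq]
  ext <;> simp <;> ring

lemma gross_zsmul {p q : ℕ} {O : Subring (Bq p q)} {x : Bq p q} (n : ℤ) (hx : x ∈ GrossLat O) :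
    n • x ∈ GrossLat O := by
  obtain ⟨a, ha, rfl⟩ := hx
  refine ⟨n • a, O.zsmul_mem ha n, ?_⟩
  rw [gross_eq, gross_eq]
  ext <;> simp <;> ring

lemma gross_nr {p q : ℕ} (a : Bq p q) : Nrq (2 * a - algebraMap ℚ (Bq p q) (Trq a))
    = 4 * Nrq a - Trq a ^ 2 := by
  rw [gross_eq, Nrq_eq, Nrq_eq, Trq]; simp only []; ring

lemma gross_comm {p q : ℕ} (a b : Bq p q) :
    Nrq (2 * a - algebraMap ℚ (Bq p q) (Trq a)) * Nrq (2 * b - algebraMap ℚ (Bq p q) (Trq b))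
      - Bl (2 * a - algebraMap ℚ (Bq p q) (Trq a)) (2 * b - algebraMap ℚ (Bq p q) (Trq b)) ^ 2
    = 4 * Nrq (a * b - b * a) := by
  rw [gross_eq, gross_eq, Nrq_eq, Nrq_eq, Nrq_eq, Bl]; simp; ring

lemma nrm_perp {p q : ℕ} (s t : Bq p q) (hs : s.re = 0) (ht : t.re = 0) :
      Nrq (Nrq s • t - Bl s t • s) = Nrq s * (Nrq s * Nrq t - Bl s t ^ 2) := by
  rw [Nrq_eq (_ - _), Bl, Nrq_eq s, Nrq_eq t]; simp [hs, ht]; ring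

lemma Nrq_add {p q : ℕ} (s t : Bq p q) : Nrq (s + t) = Nrq s + Nrq t + 2 * Bl s t := by
  simp only [Nrq_eq, Bl]; simp; ring

lemma Nrq_zsmul {p q : ℕ} (n : ℤ) (t : Bq p q) : Nrq (n • t) = n ^ 2 * Nrq t := by
  simp only [Nrq_eq]; simp; ring

lemma Bl_neg {p q : ℕ} (s t : Bq p q) : Bl s (-t) = - Bl s t := by
  simp [Bl]

lemma prim_dep {p q : ℕ} {O : Subring (Bq p q)} {x y : Bq p q} (hx : Primitive (GrossLat O) x)
    (hy : Primitive (GrossLat O) y) (r s : ℚ) (hr : r ≠ 0) (h : r • y = s • x) :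
    Nrq x = Nrq y := by
  obtain ⟨hxT, -, hxp⟩ := hx
  obtain ⟨hyT, -, hyp⟩ := hy
  set ρ := s / r with hρ
  have h1 : y = ρ • x := by
    have : r • y = r • (ρ • x) := by rw [h, smul_smul, hρ, mul_div_cancel₀ _ hr]
    exact smul_right_injective _ hr this
  have h2 : (ρ.den : ℤ) • y = ρ.num • x := by
    rw [h1, ← Int.cast_smul_eq_zsmul ℚ, ← Int.cast_smul_eq_zsmul ℚ, smul_smul]
    congr 1
    exact_mod_cast Rat.den_mul_eq_num ρ
  have hcop : IsCoprime ρ.num (ρ.den : ℤ) := by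
    rw [Int.isCoprime_iff_gcd_eq_one]
    exact ρ.reduced
  generalize ρ.num = n at h2 hcop
  generalize (ρ.den : ℤ) = d at h2 hcop
  obtain ⟨u, v, huv⟩ := hcop
  have hw : u • y + v • x ∈ GrossLat O := gross_add (gross_zsmul _ hyT) (gross_zsmul _ hxT)
  have e1 : x = d • (u • y + v • x) := by
    rw [smul_add, smul_comm d u, h2, smul_smul, smul_smul, ← add_smul, mul_comm d v, huv, one_smul]
  have e2 : y = n • (u • y + v • x) := by
    rw [smul_add, smul_comm n v, ← h2, smul_smul, smul_smul, ← add_smul, mul_comm n u, huv, one_smul]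
  have f1 : Nrq x = d ^ 2 * Nrq (u • y + v • x) := by
    rw [← Nrq_zsmul, ← e1]
  have f2 : Nrq y = n ^ 2 * Nrq (u • y + v • x) := by
    rw [← Nrq_zsmul, ← e2]
  rw [f1, f2]
  rcases hxp _ _ hw e1 with h | h <;> rcases hyp _ _ hw e2 with h' | h' <;> rw [h, h'] <;> norm_num

lemma gross_half {p q : ℕ} (hp : 0 < p) {O O' : Subring (Bq p q)} (hO : IsOrder O)
    (hO' : IsOrder O') (a : Bq p q) (ha : a ∈ O) (x' : Bq p q) (hx' : x' ∈ GrossLat O')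
    (h : Nrq (2 * a - algebraMap ℚ (Bq p q) (Trq a)) = Nrq x') :
    ∃ a' ∈ O', Trq a' = Trq a ∧ x' = 2 * a' - algebraMap ℚ (Bq p q) (Trq a') := by
  obtain ⟨a', ha', rfl⟩ := hx'
  obtain ⟨t, ht⟩ := Trq_int O hO a ha
  obtain ⟨t', ht'⟩ := Trq_int O' hO' a' ha'
  obtain ⟨n, hn⟩ := Nrq_int O hO a ha
  obtain ⟨n', hn'⟩ := Nrq_int O' hO' a' ha'
  rw [gross_nr, gross_nr, ht, ht', hn, hn'] at h
  have h' : 4 * n - t ^ 2 = 4 * n' - t' ^ 2 := by exact_mod_cast h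
  have hpar : ∃ m, t = t' + 2 * m := by
    have h2 : (t - t') * (t + t') = 4 * (n - n') := by linarith
    have h3 : (t - t') % 2 = 0 := by
      rcases Int.emod_two_eq_zero_or_one (t - t') with h | h
      · exact h
      · exfalso
        have h4 : ((t - t') * (t + t')) % 2 = 1 := by
          rw [Int.mul_emod, h, show (t + t') % 2 = 1 by omega]; norm_num
        omega
    exact ⟨(t - t') / 2, by omega⟩
  obtain ⟨m, hm⟩ := hpar
  refine ⟨a' + (m : Bq p q), O'.add_mem ha' (intCast_mem _ m), ?_, ?_⟩
  · rw [ht, hm]; push_cast; rw [← ht', Trq, Trq]; simp; ring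
  · rw [gross_eq, gross_eq]; ext <;> simp

lemma core {p q : ℕ} (hp : p.Prime) (hq : q.Prime) (O O' : Subring (Bq p q))
    (hO : IsOrder O) (hO' : IsOrder O')
    (hl1 : ∀ s ∈ O, ∀ t ∈ O, ∃ k : ℤ, Nrq (s * t - t * s) = p * k)
    (hl2 : ∀ s ∈ O, ∀ k : ℤ, Nrq s = p * k → ∃ l : ℤ, Trq s = p * l)
    (hl1' : ∀ s ∈ O', ∀ t ∈ O', ∃ k : ℤ, Nrq (s * t - t * s) = p * k)
    (hl2' : ∀ s ∈ O', ∀ k : ℤ, Nrq s = p * k → ∃ l : ℤ, Trq s = p * l)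
    (x y x' y' : Bq p q) (hx : x ∈ GrossLat O) (hy : y ∈ GrossLat O)
    (hx' : x' ∈ GrossLat O') (hy' : y' ∈ GrossLat O')
    (h1 : Nrq x = Nrq x') (h2 : Nrq y = Nrq y') (h3 : Bl x y = Bl x' y')
    (hx0 : Nrq x ≠ 0) (hd : Nrq x * Nrq y - Bl x y ^ 2 = 4 * p) : SameType O O' := by
  have hp0 : (p : ℚ) ≠ 0 := by exact_mod_cast hp.ne_zero
  obtain ⟨c, hc0, hcx, hcy⟩ := exists_conj x y x' y' (gross_re hx) (gross_re hy) (gross_re hx')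
    (gross_re hy') h1 h2 h3 hx0 (by rw [hd]; simpa using hp0)
  have hd' : Nrq x' * Nrq y' - Bl x' y' ^ 2 = 4 * p := by rw [← h1, ← h2, ← h3, hd]
  obtain ⟨a, ha, rfl⟩ := hx
  obtain ⟨b, hb, rfl⟩ := hy
  obtain ⟨a', ha', hta, rfl⟩ := gross_half hp.pos hO hO' a ha x' hx' h1
  obtain ⟨b', hb', htb, rfl⟩ := gross_half hp.pos hO hO' b hb y' hy' h2
  rw [gross_comm] at hd hd'
  have hab : Nrq (a * b - b * a) = p := by linarith
  have hab' : Nrq (a' * b' - b' * a') = p := by linarith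
  have half : ∀ s s' : Bq p q, Trq s' = Trq s →
      c * (2 * s - algebraMap ℚ (Bq p q) (Trq s)) =
      (2 * s' - algebraMap ℚ (Bq p q) (Trq s')) * c → c * s = s' * c := by
    intro s s' ht h
    rw [ht, mul_sub, sub_mul, ← Algebra.commutes, sub_left_inj, two_mul, two_mul, mul_add,
      add_mul] at h
    have : (2 : ℚ) • (c * s) = (2 : ℚ) • (s' * c) := by rw [two_smul, two_smul, h]
    exact smul_right_injective _ (by norm_num : (2 : ℚ) ≠ 0) this
  have hca := half a a' hta hcx
  have hcb := half b b' htb hcy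
  have hcc : c * qinv c = 1 := by
    have hN : Nrq c ≠ 0 := (Nrq_pos hp.pos hq.pos c hc0).ne'
    have : c * star c = Nrq c • (1 : Bq p q) := by
      rw [Nrq_eq]; ext <;> simp <;> ring
    rw [qinv, mul_smul_comm, this, smul_smul, inv_mul_cancel₀ hN, one_smul]
  have himg : ∀ n0 n1 n2 n3 : ℤ, c * ((n0 : Bq p q) + n1 • a + n2 • b + n3 • (a * b)) * qinv c
      = (n0 : Bq p q) + n1 • a' + n2 • b' + n3 • (a' * b') := by
    intro n0 n1 n2 n3
    have : c * ((n0 : Bq p q) + n1 • a + n2 • b + n3 • (a * b))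
        = ((n0 : Bq p q) + n1 • a' + n2 • b' + n3 • (a' * b')) * c := by
      simp only [mul_add, add_mul, mul_smul_comm, smul_mul_assoc, hca, hcb]
      rw [← mul_assoc, hca, mul_assoc, hcb, mul_assoc, Int.cast_comm]
    rw [this, mul_assoc, hcc, mul_one]
  refine ⟨c, hc0, ?_⟩
  ext t
  constructor
  · rintro ⟨s, hs, rfl⟩
    obtain ⟨n0, n1, n2, n3, rfl⟩ := span_eq hp O hO hl1 hl2 a b ha hb hab s hs
    simp only [himg]
    exact O'.add_mem (O'.add_mem (O'.add_mem (intCast_mem _ _) (O'.zsmul_mem ha' _))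
      (O'.zsmul_mem hb' _)) (O'.zsmul_mem (O'.mul_mem ha' hb') _)
  · intro ht
    obtain ⟨n0, n1, n2, n3, rfl⟩ := span_eq hp O' hO' hl1' hl2' a' b' ha' hb' hab' t ht
    exact ⟨_, O.add_mem (O.add_mem (O.add_mem (intCast_mem _ n0) (O.zsmul_mem ha n1))
      (O.zsmul_mem hb n2)) (O.zsmul_mem (O.mul_mem ha hb) n3), himg _ _ _ _⟩

lemma gross_div {p q : ℕ} (O : Subring (Bq p q))
    (hl1 : ∀ s ∈ O, ∀ t ∈ O, ∃ k : ℤ, Nrq (s * t - t * s) = p * k)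
    (x y : Bq p q) (hx : x ∈ GrossLat O) (hy : y ∈ GrossLat O) :
    ∃ k : ℤ, Nrq x * Nrq y - Bl x y ^ 2 = 4 * p * k := by
  obtain ⟨a, ha, rfl⟩ := hx
  obtain ⟨b, hb, rfl⟩ := hy
  obtain ⟨k, hk⟩ := hl1 a ha b hb
  exact ⟨k, by rw [gross_comm, hk]; ring⟩

lemma gross_int {p q : ℕ} (O : Subring (Bq p q)) (hO : IsOrder O)
    (x : Bq p q) (hx : x ∈ GrossLat O) : ∃ k : ℤ, Nrq x = k := by
  obtain ⟨a, ha, rfl⟩ := hx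
  obtain ⟨n, hn⟩ := Nrq_int O hO a ha
  obtain ⟨t, ht⟩ := Trq_int O hO a ha
  exact ⟨4 * n - t ^ 2, by rw [gross_nr, hn, ht]; push_cast; ring⟩

lemma k_one {p : ℕ} (hp : 0 < p) (m s : ℚ) (k : ℤ) (h : m - s ^ 2 = 4 * p * k)
    (hpos : 0 < m - s ^ 2) (hlt : m < 16 / 3 * p) : m - s ^ 2 = 4 * p := by
  have hp' : (0 : ℚ) < p := by exact_mod_cast hp
  have h1 : (0 : ℚ) < k := by
    by_contra hk
    push Not at hk
    nlinarith
  have h2 : (k : ℚ) < 2 := by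
    by_contra hk
    push Not at hk
    nlinarith [sq_nonneg s]
  have h3 : 0 < k := by exact_mod_cast h1
  have h4 : k < 2 := by exact_mod_cast h2
  have : k = 1 := by omega
  rw [h, this]; simp

lemma diff_minima {p : ℕ} (hp : p.Prime) (hp12 : 286 < p) (d s : ℤ) (h : d ^ 2 - s ^ 2 = 4 * p)
    (h1 : 2 * s ≤ d) (h2 : -d ≤ 2 * s) (hd : 0 < d) : False := by
  have hdv : (p : ℤ) ∣ (d - s) * (d + s) := ⟨4, by linarith⟩
  have hpp : (286 : ℤ) < p := by exact_mod_cast hp12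
  have hb : (2 * p : ℤ) ≤ 3 * d := by
    rcases (Nat.prime_iff_prime_int.mp hp).dvd_or_dvd hdv with h | h
    · have := Int.le_of_dvd (by linarith) h
      linarith
    · have := Int.le_of_dvd (by linarith) h
      linarith
  have hs : 4 * s ^ 2 ≤ d ^ 2 := by nlinarith
  nlinarith

end GrossPaper
/-- Theorem maintheorem. -/
theorem main_theorem (p q : ℕ) (hp : Nat.Prime p) (hodd : Odd p) (hq : Nat.Prime q)
    (hq8 : q % 8 = 3) (hqr : ∃ r : ℤ, (q : ℤ) ∣ r ^ 2 + p)
    (O O' : Subring (Bq p q)) (hO : IsMaximalOrder O) (hO' : IsMaximalOrder O')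
    (D₁ D₂ D₃ : ℝ) (x y z : Bq p q)
    (hm1 : SuccMin (GrossLat O) 1 D₁) (hm2 : SuccMin (GrossLat O) 2 D₂)
    (hm3 : SuccMin (GrossLat O) 3 D₃)
    (hx : x ∈ GrossLat O) (hy : y ∈ GrossLat O) (hz : z ∈ GrossLat O)
    (hxD : (Nrq x : ℝ) = D₁) (hyD : (Nrq y : ℝ) = D₂) (hzD : (Nrq z : ℝ) = D₃)
    (hxy : LinearIndependent ℚ ![x, y])
    (hzxy : z ∉ Submodule.span ℚ ({x, y} : Set (Bq p q)))
    (h1 : OptRep (GrossLat O') D₁) (h2 : OptRep (GrossLat O') D₂)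
    (h3 : OptRep (GrossLat O') ((Nrq (x + y) : ℝ)))
    (h4 : OptRep (GrossLat O') ((Nrq (x - y) : ℝ)))
    (h5 : OptRep (GrossLat O') D₃)
    (hθ : thetaOpt (GrossLat O) D₃ ≤ thetaOpt (GrossLat O') D₃)
    (hc1 : D₁ * D₂ < 16 / 3 * p) (hc2 : 15 ≤ D₁) (hc3 : 286 < p) :
    SameType O O' := by
  obtain ⟨hO, -⟩ := hO
  obtain ⟨hO', -⟩ := hO'
  obtain ⟨hl1, hl2⟩ := local_facts hp hodd hq hq8 hqr O hO
  obtain ⟨hl1', hl2'⟩ := local_facts hp hodd hq hq8 hqr O' hO'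
  obtain ⟨x', hx', hx'D⟩ := h1
  obtain ⟨y', hy', hy'D⟩ := h2
  have e1 : Nrq x = Nrq x' := by
    have : (Nrq x : ℝ) = Nrq x' := by rw [hxD, hx'D]
    exact_mod_cast this
  have e2 : Nrq y = Nrq y' := by
    have : (Nrq y : ℝ) = Nrq y' := by rw [hyD, hy'D]
    exact_mod_cast this
  have hlt : Nrq x * Nrq y < 16 / 3 * p := by
    rw [← hxD, ← hyD] at hc1
    have h' : ((Nrq x * Nrq y : ℚ) : ℝ) < ((16 / 3 * p : ℚ) : ℝ) := by
      push_cast; exact hc1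
    exact_mod_cast h'
  have hpair := LinearIndependent.pair_iff.mp hxy
  have hx0 : x ≠ 0 := by
    rintro rfl
    have := (hpair 1 0 (by simp)).1
    norm_num at this
  have hNx := Nrq_pos hp.pos hq.pos x hx0
  have min1 : ∀ t ∈ GrossLat O, t ≠ 0 → Nrq x ≤ Nrq t := by
    intro t ht ht0
    have := hm1.2 ⟨fun _ => t, fun _ => ht, LinearIndependent.of_subsingleton (0 : Fin 1) ht0,
      fun _ => le_rfl⟩
    rw [← hxD] at this
    exact_mod_cast this
  have min2 : ∀ n : ℤ, Nrq y ≤ Nrq (y + n • x) := by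
    intro n
    have hmem : y + n • x ∈ GrossLat O := gross_add hy (gross_zsmul n hx)
    have hind : ∀ s t : ℚ, s • x + t • (y + n • x) = 0 → s = 0 ∧ t = 0 := by
      intro s t h
      have h' : (s + t * n) • x + t • y = 0 := by
        rw [← h, ← Int.cast_smul_eq_zsmul ℚ]; module
      obtain ⟨f1, f2⟩ := hpair _ _ h'
      rw [f2] at f1
      exact ⟨by simpa using f1, f2⟩
    have hne : y + n • x ≠ 0 := by
      intro h
      have := (hind 0 1 (by rw [h]; simp)).2
      norm_num at this
    by_contra hcon
    push Not at hcon
    have g1 := min1 _ hmem hne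
    have hset : ∃ v : Fin 2 → Bq p q, (∀ n, v n ∈ GrossLat O) ∧ LinearIndependent ℚ v ∧
        ∀ m, ((Nrq (v m) : ℝ) ≤ ((max (Nrq x) (Nrq (y + n • x)) : ℚ) : ℝ)) := by
      refine ⟨![x, y + n • x], ?_, LinearIndependent.pair_iff.mpr hind, ?_⟩
      · intro i
        fin_cases i
        · exact hx
        · exact hmem
      · intro i
        fin_cases i
        · exact Rat.cast_le.mpr (le_max_left (Nrq x) (Nrq (y + n • x)))
        · exact Rat.cast_le.mpr (le_max_right (Nrq x) (Nrq (y + n • x)))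
    have := hm2.2 hset
    rw [← hyD] at this
    have h3 : Nrq y ≤ max (Nrq x) (Nrq (y + n • x)) := by exact_mod_cast this
    rw [max_eq_right g1] at h3
    linarith
  have posO : 0 < Nrq x * Nrq y - Bl x y ^ 2 := by
    have hne : Nrq x • y - Bl x y • x ≠ 0 := by
      intro h
      have := (hpair (-Bl x y) (Nrq x) (by rw [← h]; module)).2
      exact hNx.ne' this
    have := Nrq_pos hp.pos hq.pos _ hne
    rw [nrm_perp x y (gross_re hx) (gross_re hy)] at this
    exact pos_of_mul_pos_right this hNx.le
  obtain ⟨k, hk⟩ := gross_div O hl1 x y hx hy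
  have hd := k_one hp.pos _ _ k hk posO hlt
  have hne : Nrq x ≠ Nrq y := by
    intro heq
    obtain ⟨d, hd'⟩ := gross_int O hO x hx
    have hy' : Nrq y = d := by rw [← heq, hd']
    obtain ⟨s, hs⟩ := rat_sq_int (Bl x y) (d ^ 2 - 4 * p) (by
      push_cast; rw [hd', hy'] at hd; linarith)
    have m1 := min2 1
    have m2 := min2 (-1)
    have hBs : Bl y ((1 : ℤ) • x) = Bl x y := by simp [Bl]; ring
    have hBs' : Bl y ((-1 : ℤ) • x) = - Bl x y := by simp [Bl]; ring
    rw [Nrq_add, Nrq_zsmul, hBs, hd', hs] at m1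
    rw [Nrq_add, Nrq_zsmul, hBs', hd', hs] at m2
    push_cast at m1 m2
    rw [hd', hy', hs] at hd
    rw [hd'] at hNx
    refine diff_minima hp hc3 d s ?_ ?_ ?_ (by exact_mod_cast hNx)
    · have : (d : ℚ) ^ 2 - s ^ 2 = 4 * p := by linarith
      exact_mod_cast this
    · have : 2 * (s : ℚ) ≤ d := by linarith
      exact_mod_cast this
    · have : -(d : ℚ) ≤ 2 * s := by linarith
      exact_mod_cast this
  have hNx' : 0 < Nrq x' := e1 ▸ hNx
  have posO' : 0 < Nrq x' * Nrq y' - Bl x' y' ^ 2 := by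
    have hne' : Nrq x' • y' - Bl x' y' • x' ≠ 0 := by
      intro h
      apply hne
      rw [e1, e2]
      exact prim_dep hx' hy' _ _ hNx'.ne' (sub_eq_zero.mp h)
    have := Nrq_pos hp.pos hq.pos _ hne'
    rw [nrm_perp x' y' (gross_re hx'.1) (gross_re hy'.1)] at this
    exact pos_of_mul_pos_right this hNx'.le
  obtain ⟨k', hk'⟩ := gross_div O' hl1' x' y' hx'.1 hy'.1
  have hd' := k_one hp.pos _ _ k' hk' posO' (by rw [← e1, ← e2]; exact hlt)
  have hsq : Bl x y ^ 2 = Bl x' y' ^ 2 := by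
    rw [← e1, ← e2] at hd'; linarith
  rcases sq_eq_sq_iff_eq_or_eq_neg.mp hsq with h | h
  · exact core hp hq O O' hO hO' hl1 hl2 hl1' hl2' x y x' y' hx hy hx'.1 hy'.1 e1 e2 h hNx.ne' hd
  · refine core hp hq O O' hO hO' hl1 hl2 hl1' hl2' x y x' (-y') hx hy hx'.1 ?_ e1 ?_ ?_ hNx.ne' hd
    · have := gross_zsmul (-1) hy'.1
      simpa using this
    · have := Nrq_zsmul (-1) y'
      rw [e2]
      simpa using this.symm
    · rw [h, Bl_neg]
end

section
/- Let O be a maximal order of B_p with first two successive minima D₁ ≤ D₂ of O^T. If O^T contains a rank-2 ℤ-sublattice Λ = ℤu + ℤv (u, v ℚ-linearly independent) whose Gram matrix with respect to the bilinear form (u,v) ↦ ½Tr(u·v̄) has determinant 4p, then D₁·D₂ ≤ (16/3)·p. -/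
open scoped Quaternion

open GrossPaper

def bfx {p q : ℕ} (x y : Bq p q) : ℚ := (x * star y).re

theorem bfx_eq {p q : ℕ} (x y : Bq p q) :
    bfx x y = x.re * y.re + p * (x.imI * y.imI) + q * (x.imJ * y.imJ)
      + p * q * (x.imK * y.imK) := by
  simp [bfx]; ring

theorem bfx_nonneg {p q : ℕ} (x : Bq p q) : 0 ≤ bfx x x := by
  rw [bfx_eq]
  have h1 := mul_self_nonneg x.re
  have h2 := mul_self_nonneg x.imI
  have h3 := mul_self_nonneg x.imJ
  have h4 := mul_self_nonneg x.imK
  positivity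

theorem gross_add {p q : ℕ} {O : Subring (Bq p q)} {u v : Bq p q}
    (hu : u ∈ GrossLat O) (hv : v ∈ GrossLat O) : v + u ∈ GrossLat O := by
  obtain ⟨x, hx, rfl⟩ := hu
  obtain ⟨y, hy, rfl⟩ := hv
  refine ⟨y + x, O.add_mem hy hx, ?_⟩
  have : Trq (y + x) = Trq y + Trq x := by simp [Trq]; ring
  rw [this, map_add, mul_add]; abel

theorem gross_sub {p q : ℕ} {O : Subring (Bq p q)} {u v : Bq p q}
    (hu : u ∈ GrossLat O) (hv : v ∈ GrossLat O) : v - u ∈ GrossLat O := by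
  obtain ⟨x, hx, rfl⟩ := hu
  obtain ⟨y, hy, rfl⟩ := hv
  refine ⟨y - x, O.sub_mem hy hx, ?_⟩
  have : Trq (y - x) = Trq y - Trq x := by simp [Trq]; ring
  rw [this, map_sub, mul_sub]; abel

theorem bfx_add {p q : ℕ} (u v : Bq p q) : bfx (v + u) (v + u) = bfx v v + 2 * bfx u v + bfx u u := by
  simp only [bfx_eq, QuaternionAlgebra.re_add, QuaternionAlgebra.imI_add,
    QuaternionAlgebra.imJ_add, QuaternionAlgebra.imK_add]; ring

theorem bfx_sub {p q : ℕ} (u v : Bq p q) : bfx (v - u) (v - u) = bfx v v - 2 * bfx u v + bfx u u := by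
  simp only [bfx_eq, QuaternionAlgebra.re_sub, QuaternionAlgebra.imI_sub,
    QuaternionAlgebra.imJ_sub, QuaternionAlgebra.imK_sub]; ring

theorem bfx_add' {p q : ℕ} (u v : Bq p q) : bfx u (v + u) = bfx u v + bfx u u := by
  simp only [bfx_eq, QuaternionAlgebra.re_add, QuaternionAlgebra.imI_add,
    QuaternionAlgebra.imJ_add, QuaternionAlgebra.imK_add]; ring

theorem bfx_sub' {p q : ℕ} (u v : Bq p q) : bfx u (v - u) = bfx u v - bfx u u := by
  simp only [bfx_eq, QuaternionAlgebra.re_sub, QuaternionAlgebra.imI_sub,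
    QuaternionAlgebra.imJ_sub, QuaternionAlgebra.imK_sub]; ring

theorem bfx_comm {p q : ℕ} (u v : Bq p q) : bfx u v = bfx v u := by
  simp only [bfx_eq]; ring

theorem gauss_red {p q : ℕ} (O : Subring (Bq p q)) (N : ℚ) (hN : 0 < N) (d : ℚ) (n : ℕ) :
    ∀ (u v : Bq p q) (A B C : ℤ), u ∈ GrossLat O → v ∈ GrossLat O →
      N * bfx u u = A → N * bfx u v = B → N * bfx v v = C →
      bfx u u * bfx v v - bfx u v ^ 2 = d → A + C ≤ n →
      ∃ u' v' : Bq p q, u' ∈ GrossLat O ∧ v' ∈ GrossLat O ∧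
        bfx u' u' * bfx v' v' - bfx u' v' ^ 2 = d ∧ 2 * |bfx u' v'| ≤ bfx u' u' ∧
        bfx u' u' ≤ bfx v' v' := by
  induction n with
  | zero =>
    intro u v A B C hu hv hA hB hC hd hn
    have h1 := bfx_nonneg u
    have h2 := bfx_nonneg v
    have h3 : (0:ℚ) ≤ A := by rw [← hA]; positivity
    have h4 : (0:ℚ) ≤ C := by rw [← hC]; positivity
    have h3' : 0 ≤ A := by exact_mod_cast h3
    have h4' : 0 ≤ C := by exact_mod_cast h4
    have hA0 : A = 0 := by push_cast at hn; omega
    have hC0 : C = 0 := by push_cast at hn; omega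
    have hu0 : bfx u u = 0 := by
      rw [hA0] at hA; simpa [hN.ne'] using hA
    have hv0 : bfx v v = 0 := by
      rw [hC0] at hC; simpa [hN.ne'] using hC
    have e1 := bfx_nonneg (v + u)
    have e2 := bfx_nonneg (v - u)
    rw [bfx_add] at e1
    rw [bfx_sub] at e2
    have : bfx u v = 0 := by linarith
    exact ⟨u, v, hu, hv, hd, by simp [this, hu0], by rw [hu0, hv0]⟩
  | succ n ih =>
    have key : ∀ (u v : Bq p q) (A B C : ℤ), u ∈ GrossLat O → v ∈ GrossLat O →
      N * bfx u u = A → N * bfx u v = B → N * bfx v v = C →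
      bfx u u * bfx v v - bfx u v ^ 2 = d → A + C ≤ (n + 1 : ℕ) → bfx u u ≤ bfx v v →
      ∃ u' v' : Bq p q, u' ∈ GrossLat O ∧ v' ∈ GrossLat O ∧
        bfx u' u' * bfx v' v' - bfx u' v' ^ 2 = d ∧ 2 * |bfx u' v'| ≤ bfx u' u' ∧
        bfx u' u' ≤ bfx v' v' := by
      intro u v A B C hu hv hA hB hC hd hn hle
      by_cases hr : 2 * |bfx u v| ≤ bfx u u
      · exact ⟨u, v, hu, hv, hd, hr, hle⟩
      push Not at hr
      push_cast at hn
      rcases le_total 0 (bfx u v) with h0 | h0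
      · rw [abs_of_nonneg h0] at hr
        have : (A : ℚ) < 2 * B := by rw [← hA, ← hB]; nlinarith
        have : A < 2 * B := by exact_mod_cast this
        refine ih u (v - u) A (B - A) (C - 2 * B + A) hu (gross_sub hu hv) hA ?_ ?_ ?_ (by omega)
        · rw [bfx_sub']; push_cast; rw [← hA, ← hB]; ring
        · rw [bfx_sub]; push_cast; rw [← hA, ← hB, ← hC]; ring
        · rw [bfx_sub, bfx_sub', ← hd]; ring
      · rw [abs_of_nonpos h0] at hr
        have : (A : ℚ) < - (2 * B) := by rw [← hA, ← hB]; nlinarith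
        have : A < - (2 * B) := by exact_mod_cast this
        refine ih u (v + u) A (B + A) (C + 2 * B + A) hu (gross_add hu hv) hA ?_ ?_ ?_ (by omega)
        · rw [bfx_add']; push_cast; rw [← hA, ← hB]; ring
        · rw [bfx_add]; push_cast; rw [← hA, ← hB, ← hC]; ring
        · rw [bfx_add, bfx_add', ← hd]; ring
    intro u v A B C hu hv hA hB hC hd hn
    rcases le_total (bfx u u) (bfx v v) with h | h
    · exact key u v A B C hu hv hA hB hC hd hn h
    · exact key v u C B A hv hu hC (by rw [bfx_comm, hB]) hA
        (by rw [bfx_comm v u, ← hd]; ring) (by omega) h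

/-- Lemma on the conditions, via Kaneko's sublattice. -/
theorem lemma_conditions (p q : ℕ) (hp : Nat.Prime p) (hodd : Odd p) (hq : Nat.Prime q)
    (hq8 : q % 8 = 3) (hqr : ∃ r : ℤ, (q : ℤ) ∣ r ^ 2 + p)
    (O : Subring (Bq p q)) (hO : IsMaximalOrder O)
    (D₁ D₂ : ℝ) (hm1 : SuccMin (GrossLat O) 1 D₁) (hm2 : SuccMin (GrossLat O) 2 D₂)
    (hD12 : D₁ ≤ D₂)
    (u v : Bq p q) (hu : u ∈ GrossLat O) (hv : v ∈ GrossLat O)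
    (huv : LinearIndependent ℚ ![u, v])
    (hgram : (Matrix.of fun i j : Fin 2 =>
      (1 / 2 : ℚ) * Trq (![u, v] i * star (![u, v] j))).det = 4 * p) :
    D₁ * D₂ ≤ 16 / 3 * p := by
  have hd : bfx u u * bfx v v - bfx u v ^ 2 = 4 * p := by
    rw [← hgram, Matrix.det_fin_two]
    simp only [Matrix.of_apply, Trq, Matrix.cons_val_zero, Matrix.cons_val_one]
    have := bfx_comm u v
    have e : (v * star u).re = bfx u v := by rw [this]; rfl
    rw [e]; simp only [bfx]; ring
  have hp0 : (0:ℚ) < p := by exact_mod_cast hp.pos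
  obtain ⟨u', v', hu', hv', hd', hr, hle⟩ : ∃ u' v' : Bq p q, u' ∈ GrossLat O ∧ v' ∈ GrossLat O ∧
        bfx u' u' * bfx v' v' - bfx u' v' ^ 2 = 4 * p ∧ 2 * |bfx u' v'| ≤ bfx u' u' ∧
        bfx u' u' ≤ bfx v' v' := by
    obtain ⟨a, ha⟩ : ∃ a, a = bfx u u := ⟨_, rfl⟩
    obtain ⟨b, hb⟩ : ∃ a, a = bfx u v := ⟨_, rfl⟩
    obtain ⟨c, hc⟩ : ∃ a, a = bfx v v := ⟨_, rfl⟩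
    have hda : (0:ℚ) < a.den := by exact_mod_cast a.den_pos
    have hdb : (0:ℚ) < b.den := by exact_mod_cast b.den_pos
    have hdc : (0:ℚ) < c.den := by exact_mod_cast c.den_pos
    refine gauss_red O (a.den * b.den * c.den) (by positivity) (4 * p)
      (a.num * b.den * c.den + c.num * a.den * b.den).toNat u v
      (a.num * b.den * c.den) (b.num * a.den * c.den) (c.num * a.den * b.den) hu hv ?_ ?_ ?_ hd
      (Int.self_le_toNat _)
    · rw [← ha]; push_cast; rw [← Rat.mul_den_eq_num a]; ring
    · rw [← hb]; push_cast; rw [← Rat.mul_den_eq_num b]; ring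
    · rw [← hc]; push_cast; rw [← Rat.mul_den_eq_num c]; ring
  have hli : LinearIndependent ℚ ![u', v'] := by
    rw [LinearIndependent.pair_iff]
    intro s t hst
    have lin : ∀ w : Bq p q, s * bfx u' w + t * bfx v' w = 0 := by
      intro w
      have : bfx (s • u' + t • v') w = 0 := by rw [hst]; simp [bfx]
      rw [← this]
      simp only [bfx_eq, QuaternionAlgebra.re_add, QuaternionAlgebra.imI_add,
        QuaternionAlgebra.imJ_add, QuaternionAlgebra.imK_add, QuaternionAlgebra.re_smul,
        QuaternionAlgebra.imI_smul, QuaternionAlgebra.imJ_smul, QuaternionAlgebra.imK_smul,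
        smul_eq_mul]
      ring
    have l1 := lin u'
    have l2 := lin v'
    rw [bfx_comm v' u'] at l1
    have h4 : (4 * p : ℚ) ≠ 0 := by positivity
    constructor
    · have : s * (4 * p) = 0 := by
        rw [← hd']; linear_combination bfx v' v' * l1 - bfx u' v' * l2
      exact (mul_eq_zero.mp this).resolve_right h4
    · have : t * (4 * p) = 0 := by
        rw [← hd']; linear_combination bfx u' u' * l2 - bfx u' v' * l1
      exact (mul_eq_zero.mp this).resolve_right h4
  have hne : u' ≠ 0 := by simpa using hli.ne_zero 0
  have hD1 : D₁ ≤ (bfx u' u' : ℝ) := by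
    refine hm1.2 ⟨fun _ => u', fun _ => hu', ?_, fun _ => le_rfl⟩
    exact LinearIndependent.of_subsingleton 0 hne
  have hD2 : D₂ ≤ (bfx v' v' : ℝ) := by
    refine hm2.2 ⟨![u', v'], ?_, hli, ?_⟩
    · intro n; fin_cases n
      · exact hu'
      · exact hv'
    · intro n; fin_cases n
      · exact_mod_cast hle
      · exact le_rfl
  have hD0 : 0 ≤ D₁ := by
    obtain ⟨w, -, -, hw⟩ := hm1.1
    refine le_trans ?_ (hw 0)
    exact_mod_cast bfx_nonneg (w 0)
  have hfin : bfx u' u' * bfx v' v' ≤ 16 / 3 * p := by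
    have h1 := bfx_nonneg u'
    have h2 : (2 * |bfx u' v'|) ^ 2 ≤ bfx u' u' ^ 2 := by gcongr
    rw [mul_pow, sq_abs] at h2
    nlinarith
  have hfin' : (bfx u' u' : ℝ) * bfx v' v' ≤ 16 / 3 * p := by
    have h := (Rat.cast_le (K := ℝ)).mpr hfin
    push_cast at h
    exact h
  refine le_trans (mul_le_mul hD1 hD2 (hD0.trans hD12) (hD0.trans hD1)) hfin'
end
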